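/- arXiv:1805.11373 — 2 statements merged into one kernel-verified Lean document; each statement's English description precedes it below -/
import Mathlib

section
/- Let u, u' ∈ ℤⁿ be primitive vectors (the gcd of the coordinates of each is 1) that are linearly independent over ℚ. Then the elements 1 − e^{u} and 1 − e^{u'} are relatively prime in the group algebra ℤ[ℤⁿ] (the Laurent polynomial ring in n variables over ℤ): every common divisor of 1 − e^{u} and 1 − e^{u'} in ℤ[ℤⁿ] is a unit. -/
namespace AddMonoidAlgebra

/-- For an additive weight `f` on `ℤⁿ`, the product of two nonzero elements of `R[ℤⁿ]` has a
nonzero coefficient at a sum of two exponents, one of maximal weight in each factor. -/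
theorem exists_coeff_mul_ne_zero_of_weight_max {R : Type*} [Semiring R] [NoZeroDivisors R] {n : ℕ}
    (f : (Fin n → ℤ) →+ ℤ) {p q : AddMonoidAlgebra R (Fin n → ℤ)} (hp : p ≠ 0) (hq : q ≠ 0) :
    ∃ a ∈ p.coeff.support, ∃ b ∈ q.coeff.support, (∀ x ∈ p.coeff.support, f x ≤ f a) ∧
      (∀ y ∈ q.coeff.support, f y ≤ f b) ∧ (p * q).coeff (a + b) ≠ 0 := by
  let φ : (Fin n → ℤ) → ℤ ×ₗ Lex (Fin n → ℤ) := fun x => toLex (f x, toLex x)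
  have φ_add (x y) : φ (x + y) = φ x + φ y := by
    simp only [φ, map_add]
    rfl
  have φ_inj : Function.Injective φ := fun x y h => by
    simpa [φ] using congrArg (fun z => ofLex (ofLex z).2) h
  have le_of_φ_le {x y} (h : φ x ≤ φ y) : f x ≤ f y :=
    Prod.Lex.monotone_fst _ _ h
  simp only [ne_eq, ← coeff_eq_zero, ← Finsupp.support_nonempty_iff] at hp hq
  obtain ⟨a, ha, hamax⟩ := Finset.exists_max_image _ φ hp
  obtain ⟨b, hb, hbmax⟩ := Finset.exists_max_image _ φ hq
  refine ⟨a, ha, b, hb, fun x hx => le_of_φ_le (hamax x hx),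
    fun y hy => le_of_φ_le (hbmax y hy), ?_⟩
  have huniq : UniqueAdd p.coeff.support q.coeff.support a b := fun x y hx hy hxy => by
    have h := congrArg φ hxy
    rw [φ_add, φ_add] at h
    obtain ⟨h₁, h₂⟩ := (add_eq_add_iff_eq_and_eq (hamax x hx) (hbmax y hy)).1 h
    exact ⟨φ_inj h₁, φ_inj h₂⟩
  rw [coeff_mul_add_of_uniqueAdd huniq]
  exact mul_ne_zero (Finsupp.mem_support_iff.1 ha) (Finsupp.mem_support_iff.1 hb)

/-- A factor of a nonzero homogeneous element of `R[ℤⁿ]` is homogeneous. -/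
theorem weight_eq_of_dvd {R : Type*} [Semiring R] [NoZeroDivisors R] {n : ℕ}
    (f : (Fin n → ℤ) →+ ℤ) {p r : AddMonoidAlgebra R (Fin n → ℤ)} (hr : r ≠ 0) {c : ℤ}
    (hrf : ∀ x ∈ r.coeff.support, f x = c) (hpr : p ∣ r) {x y : Fin n → ℤ}
    (hx : x ∈ p.coeff.support) (hy : y ∈ p.coeff.support) : f x = f y := by
  obtain ⟨q, rfl⟩ := hpr
  have hp := left_ne_zero_of_mul hr
  have hq := right_ne_zero_of_mul hr
  obtain ⟨a, -, b, hb, hamax, -, hab⟩ := exists_coeff_mul_ne_zero_of_weight_max f hp hq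
  obtain ⟨a', -, b', -, hamin, hbmin, hab'⟩ := exists_coeff_mul_ne_zero_of_weight_max (-f) hp hq
  have h := hrf _ (Finsupp.mem_support_iff.2 hab)
  have h' := hrf _ (Finsupp.mem_support_iff.2 hab')
  rw [map_add] at h h'
  simp only [AddMonoidHom.neg_apply, neg_le_neg_iff] at hamin hbmin
  linarith [hamax x hx, hamax y hy, hamin x hx, hamin y hy, hbmin b hb]

theorem coeff_one_sub_single_zero {R G : Type*} [Ring R] [AddMonoid G] {u : G} (hu : u ≠ 0) :
    (1 - single u 1 : AddMonoidAlgebra R G).coeff 0 = 1 := by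
  simp [coeff_sub, hu]

/-- Any two exponents of a divisor of `1 - e^u` differ by a vector parallel to `u`. -/
theorem sub_mul_eq_sub_mul_of_dvd_one_sub_single {R : Type*} [Ring R] [Nontrivial R]
    [NoZeroDivisors R] {n : ℕ} {u : Fin n → ℤ} (hu : u ≠ 0)
    {p : AddMonoidAlgebra R (Fin n → ℤ)} (hp : p ∣ 1 - single u 1) {x y : Fin n → ℤ}
    (hx : x ∈ p.coeff.support) (hy : y ∈ p.coeff.support) (i j : Fin n) :
    (x i - y i) * u j = (x j - y j) * u i := by
  let f : (Fin n → ℤ) →+ ℤ :=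
    (AddMonoidHom.mulRight (u j)).comp (Pi.evalAddMonoidHom _ i) -
      (AddMonoidHom.mulRight (u i)).comp (Pi.evalAddMonoidHom _ j)
  have f_apply (z) : f z = z i * u j - z j * u i := rfl
  have hne : (1 - single u 1 : AddMonoidAlgebra R (Fin n → ℤ)) ≠ 0 := fun h => by
    simpa [h] using coeff_one_sub_single_zero (R := R) hu
  have hf : ∀ z ∈ (1 - single u 1 : AddMonoidAlgebra R (Fin n → ℤ)).coeff.support, f z = 0 := by
    intro z hz
    have hz' : z = 0 ∨ z = u := by
      by_contra! h
      simp [coeff_sub, one_def, h.1.symm, h.2.symm] at hz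
    rcases hz' with rfl | rfl
    · exact map_zero f
    · rw [f_apply]; ring
  have h := weight_eq_of_dvd f hne hf hp hx hy
  rw [f_apply, f_apply] at h
  linarith

end AddMonoidAlgebra

/-- An integer vector parallel to two linearly independent integer vectors is zero. -/
theorem eq_zero_of_parallel_of_linearIndependent {n : ℕ} {u u' d : Fin n → ℤ}
    (hind : LinearIndependent ℚ ![fun k => ((u k : ℚ)), fun k => ((u' k : ℚ))])
    (h : ∀ i j, d i * u j = d j * u i) (h' : ∀ i j, d i * u' j = d j * u' i) : d = 0 := by
  ext i
  by_contra hi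
  change d i ≠ 0 at hi
  have hcross (j) : u' i * u j = u i * u' j :=
    mul_left_cancel₀ hi (by linear_combination u' i * h i j - u i * h' i j)
  have hui : u i = 0 := by
    have := (LinearIndependent.pair_iff.1 hind (u' i) (-u i) (by
      ext j
      have := congrArg (Int.cast : ℤ → ℚ) (hcross j)
      push_cast at this
      simp [this])).2
    simpa using this
  refine hind.ne_zero 0 ?_
  ext j
  have := h i j
  simpa [hui, hi] using this

/-- Let `u, u' ∈ ℤⁿ` be primitive vectors (gcd of coordinates `1`)
that are linearly independent over `ℚ`.  Then `1 - e^u` and `1 - e^{u'}` are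
relatively prime in the group algebra `ℤ[ℤⁿ]`: every common divisor is a unit. -/
theorem stmt2 (n : ℕ) (u u' : Fin n → ℤ)
    (hu : Finset.univ.gcd u = 1) (hu' : Finset.univ.gcd u' = 1)
    (hind : LinearIndependent ℚ ![fun k => ((u k : ℚ)), fun k => ((u' k : ℚ))]) :
    ∀ p : AddMonoidAlgebra ℤ (Fin n → ℤ),
      p ∣ (1 - AddMonoidAlgebra.single u 1) →
      p ∣ (1 - AddMonoidAlgebra.single u' 1) →
      IsUnit p := by
  intro p hp hp'
  have hu0 : u ≠ 0 := fun h => hind.ne_zero 0 (by ext; simp [h])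
  have hu0' : u' ≠ 0 := fun h => hind.ne_zero 1 (by ext; simp [h])
  have hsub : ∀ x ∈ p.coeff.support, ∀ y ∈ p.coeff.support, x = y := fun x hx y hy =>
    sub_eq_zero.1 <| eq_zero_of_parallel_of_linearIndependent hind
      (AddMonoidAlgebra.sub_mul_eq_sub_mul_of_dvd_one_sub_single hu0 hp hx hy)
      (AddMonoidAlgebra.sub_mul_eq_sub_mul_of_dvd_one_sub_single hu0' hp' hx hy)
  obtain ⟨q, hq⟩ := hp
  have hcoeff := AddMonoidAlgebra.coeff_one_sub_single_zero (R := ℤ) hu0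
  have hp0 : p.coeff.support.Nonempty := by
    rw [Finsupp.support_nonempty_iff, Ne, AddMonoidAlgebra.coeff_eq_zero]
    rintro rfl
    simp [hq] at hcoeff
  obtain ⟨w, hw⟩ := hp0
  obtain ⟨c, rfl⟩ : ∃ c, p = AddMonoidAlgebra.single w c := by
    refine ⟨p.coeff w, AddMonoidAlgebra.coeff_injective ?_⟩
    exact Finsupp.support_subset_singleton.1 fun x hx => Finset.mem_singleton.2 (hsub x hx w hw)
  rw [hq, AddMonoidAlgebra.coeff_single_mul_apply] at hcoeff
  obtain ⟨d, hd⟩ : ∃ d, c * d = 1 := ⟨_, hcoeff⟩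
  exact IsUnit.of_mul_eq_one (AddMonoidAlgebra.single (-w) d) <| by
    rw [AddMonoidAlgebra.single_mul_single, hd, add_neg_cancel, AddMonoidAlgebra.one_def]
end

section
/- Let A be the Laurent polynomial ring ℤ[z, z^{−1}] and let S = A[y₁^{±1}, …, y_d^{±1}] be the Laurent polynomial ring in d ≥ 1 variables over A. Let σ₁, …, σ_m (m ≥ 1) be subsets of {1, …, d}. For each j let J_j be the ideal of S generated by {y_l − 1 : l ∉ σ_j}. Then the intersection ⋂_{j=1}^{m} J_j equals the ideal of S generated by the products ∏_{i ∈ τ} (1 − yᵢ), where τ ranges over all subsets of {1, …, d} such that τ is not contained in σ_j for any j = 1, …, m. -/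
namespace AddMonoidAlgebra

variable {R ι κ : Type*} [CommRing R] [DecidableEq ι]

/-- The ring endomorphism of the Laurent polynomial ring `R[yᵢ^{±1} : i ∈ ι]` which substitutes `1`
for the variables indexed by `ρ`. -/
noncomputable def setOne (R : Type*) [CommRing R] (ρ : Finset ι) :
    AddMonoidAlgebra R (ι → ℤ) →+* AddMonoidAlgebra R (ι → ℤ) :=
  mapDomainRingHom R
    (AddMonoidHom.mk' (fun v i ↦ if i ∈ ρ then (0 : ℤ) else v i) fun v w ↦ by
      ext i; by_cases hi : i ∈ ρ <;> simp [hi])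

lemma setOne_single (ρ : Finset ι) (v : ι → ℤ) (a : R) :
    setOne R ρ (single v a) = single (fun i ↦ if i ∈ ρ then 0 else v i) a := by
  simp [setOne]

lemma setOne_empty (f : AddMonoidAlgebra R (ι → ℤ)) : setOne R ∅ f = f := by
  induction f using AddMonoidAlgebra.induction_linear with
  | zero => simp
  | add f g hf hg => rw [map_add, hf, hg]
  | single v a => simp [setOne_single]

lemma setOne_setOne (ρ π : Finset ι) (f : AddMonoidAlgebra R (ι → ℤ)) :
    setOne R ρ (setOne R π f) = setOne R (ρ ∪ π) f := by
  induction f using AddMonoidAlgebra.induction_linear with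
  | zero => simp
  | add f g hf hg => simp only [map_add, hf, hg]
  | single v a =>
    simp only [setOne_single]
    congr 1
    ext i
    by_cases hi : i ∈ ρ <;> simp [hi]

lemma setOne_variable_of_mem {ρ : Finset ι} {l : ι} (hl : l ∈ ρ) :
    setOne R ρ (single (Pi.single l 1) 1) = 1 := by
  rw [setOne_single, one_def]
  congr 1
  ext i
  by_cases hi : i = l
  · simp [hi, hl]
  · simp [hi]

lemma setOne_variable_of_notMem {ρ : Finset ι} {l : ι} (hl : l ∉ ρ) :
    setOne R ρ (single (Pi.single l 1) 1) = single (Pi.single l 1) 1 := by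
  rw [setOne_single]
  congr 1
  ext i
  by_cases hi : i = l
  · simp [hi, hl]
  · simp [hi]

lemma variable_sub_one_dvd_zpow_sub_one (i : ι) (n : ℤ) :
    (single (Pi.single i 1) 1 - 1 : AddMonoidAlgebra R (ι → ℤ)) ∣
      single (Pi.single i n) 1 - 1 := by
  induction n using Int.induction_on with
  | zero => simp [one_def]
  | succ n ih =>
    have h : (single (Pi.single i ((n : ℤ) + 1)) 1 : AddMonoidAlgebra R (ι → ℤ)) =
        single (Pi.single i 1) 1 * single (Pi.single i (n : ℤ)) 1 := by
      rw [single_mul_single, ← Pi.single_add, add_comm, one_mul]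
    rw [h]
    convert dvd_add (ih.mul_left (single (Pi.single i 1) 1)) dvd_rfl using 1
    ring
  | pred n ih =>
    have h : (single (Pi.single i (-(n : ℤ) - 1)) 1 : AddMonoidAlgebra R (ι → ℤ)) =
        single (Pi.single i (-1)) 1 * single (Pi.single i (-(n : ℤ))) 1 := by
      rw [single_mul_single, ← Pi.single_add, one_mul]
      congr 2
      ring
    have h' : (single (Pi.single i (-1)) 1 * single (Pi.single i 1) 1 :
        AddMonoidAlgebra R (ι → ℤ)) = 1 := by
      rw [single_mul_single, ← Pi.single_add, one_mul]
      simp [one_def]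
    rw [h]
    convert dvd_sub (ih.mul_left (single (Pi.single i (-1)) 1))
      (dvd_mul_left _ (single (Pi.single i (-1)) 1)) using 1
    linear_combination h'

lemma one_sub_variable_dvd_sub_setOne (i : ι) (f : AddMonoidAlgebra R (ι → ℤ)) :
    1 - single (Pi.single i 1) 1 ∣ f - setOne R {i} f := by
  rw [← neg_sub, neg_dvd]
  induction f using AddMonoidAlgebra.induction_linear with
  | zero => simp
  | add f g hf hg =>
    rw [map_add, add_sub_add_comm]
    exact dvd_add hf hg
  | single v a =>
    have h : (single v a : AddMonoidAlgebra R (ι → ℤ)) =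
        setOne R {i} (single v a) * single (Pi.single i (v i)) 1 := by
      rw [setOne_single, single_mul_single, mul_one]
      congr 1
      ext k
      by_cases hk : k = i
      · subst hk; simp
      · simp [hk]
    rw [show single v a - setOne R {i} (single v a) =
      setOne R {i} (single v a) * (single (Pi.single i (v i)) 1 - 1) by
        rw [mul_sub, mul_one, ← h]]
    exact (variable_sub_one_dvd_zpow_sub_one i (v i)).mul_left _

/-- The ideal generated by `y_l - 1` for `l ∉ σ`. -/
noncomputable abbrev vertexIdeal (R : Type*) [CommRing R] (σ : Finset ι) :
    Ideal (AddMonoidAlgebra R (ι → ℤ)) :=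
  Ideal.span {p | ∃ l ∉ σ, p = single (Pi.single l 1) 1 - 1}

/-- The ideal generated by the products `∏ i ∈ τ, (1 - yᵢ)` over those `τ` contained in no `σ j`. -/
noncomputable abbrev faceIdeal (R : Type*) [CommRing R] (σ : κ → Finset ι) :
    Ideal (AddMonoidAlgebra R (ι → ℤ)) :=
  Ideal.span {p | ∃ τ : Finset ι, (∀ j, ¬ τ ⊆ σ j) ∧
    p = ∏ i ∈ τ, (1 - single (Pi.single i 1) 1)}

lemma setOne_mem_vertexIdeal (ρ σ : Finset ι) {f : AddMonoidAlgebra R (ι → ℤ)}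
    (hf : f ∈ vertexIdeal R σ) : setOne R ρ f ∈ vertexIdeal R σ := by
  suffices vertexIdeal R σ ≤ (vertexIdeal R σ).comap (setOne R ρ) from this hf
  rw [Ideal.span_le]
  rintro _ ⟨l, hl, rfl⟩
  rw [SetLike.mem_coe, Ideal.mem_comap, map_sub, map_one]
  by_cases h : l ∈ ρ
  · simp [setOne_variable_of_mem h]
  · rw [setOne_variable_of_notMem h]
    exact Ideal.subset_span ⟨l, hl, rfl⟩

lemma setOne_eq_zero_of_mem_vertexIdeal {ρ σ : Finset ι} (h : ∀ l ∉ σ, l ∈ ρ)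
    {f : AddMonoidAlgebra R (ι → ℤ)} (hf : f ∈ vertexIdeal R σ) : setOne R ρ f = 0 := by
  suffices vertexIdeal R σ ≤ RingHom.ker (setOne R ρ) from this hf
  rw [Ideal.span_le]
  rintro _ ⟨l, hl, rfl⟩
  simp [setOne_variable_of_mem (h l hl)]

lemma faceIdeal_le_iInf_vertexIdeal (σ : κ → Finset ι) :
    faceIdeal R σ ≤ ⨅ j, vertexIdeal R (σ j) := by
  rw [Ideal.span_le]
  rintro _ ⟨τ, hτ, rfl⟩
  rw [SetLike.mem_coe, Ideal.mem_iInf]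
  intro j
  obtain ⟨l, hl, hlσ⟩ := Finset.not_subset.mp (hτ j)
  refine Ideal.mem_of_dvd _ (Finset.dvd_prod_of_mem _ hl) ?_
  rw [← neg_sub, neg_mem_iff]
  exact Ideal.subset_span ⟨l, hlσ, rfl⟩

/-- An element of all the vertex ideals which is divisible by `∏ i ∈ τ, (1 - yᵢ)` and does not
involve the variables in `ρ` lies in the face ideal; the induction splits off one by one the
variables outside `τ ∪ ρ`. -/
lemma mem_faceIdeal_of_prod_dvd [Fintype ι] (σ : κ → Finset ι) {τ ρ : Finset ι}
    {g : AddMonoidAlgebra R (ι → ℤ)} (hτ : ∏ i ∈ τ, (1 - single (Pi.single i 1) 1) ∣ g)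
    (hρ : setOne R ρ g = g) (hg : ∀ j, g ∈ vertexIdeal R (σ j)) : g ∈ faceIdeal R σ := by
  induction hn : (τ ∪ ρ)ᶜ.card generalizing τ ρ g with
  | zero =>
    have hcover : ∀ i, i ∈ τ ∨ i ∈ ρ := by
      rw [Finset.card_eq_zero, Finset.compl_eq_empty_iff, Finset.eq_univ_iff_forall] at hn
      simpa using hn
    by_cases h : ∀ j, ¬ τ ⊆ σ j
    · exact Ideal.mem_of_dvd _ hτ (Ideal.subset_span ⟨τ, h, rfl⟩)
    · push Not at h
      obtain ⟨j, hj⟩ := h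
      rw [← hρ, setOne_eq_zero_of_mem_vertexIdeal
        (fun l hl ↦ (hcover l).resolve_left fun h ↦ hl (hj h)) (hg j)]
      exact zero_mem _
  | succ n ih =>
    obtain ⟨i, hi⟩ : (τ ∪ ρ)ᶜ.Nonempty := Finset.card_pos.mp (by lia)
    have hcard : ((τ ∪ ρ)ᶜ.erase i).card = n := by
      rw [Finset.card_erase_of_mem hi, hn, Nat.add_sub_cancel]
    have hiτ : i ∉ τ := fun h ↦ by simp [h] at hi
    obtain ⟨h, rfl⟩ := hτ
    set g := (∏ i ∈ τ, (1 - single (Pi.single i 1) 1)) * h with hgdef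
    have hmap : setOne R {i} g =
        (∏ i ∈ τ, (1 - single (Pi.single i 1) 1)) * setOne R {i} h := by
      rw [hgdef, map_mul, map_prod]
      congr 1
      refine Finset.prod_congr rfl fun k hk ↦ ?_
      have hki : k ∉ ({i} : Finset ι) := fun h ↦ hiτ (Finset.mem_singleton.mp h ▸ hk)
      rw [map_sub, map_one, setOne_variable_of_notMem hki]
    rw [← sub_add_cancel g (setOne R {i} g)]
    refine add_mem (ih (τ := insert i τ) (ρ := ρ) ?_ ?_ ?_ ?_)
      (ih (τ := τ) (ρ := insert i ρ) ?_ ?_ ?_ ?_)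
    · rw [hmap, hgdef, ← mul_sub, Finset.prod_insert hiτ, mul_comm]
      exact mul_dvd_mul_left _ (one_sub_variable_dvd_sub_setOne i h)
    · rw [map_sub, setOne_setOne, Finset.union_comm, ← setOne_setOne, hρ]
    · exact fun j ↦ sub_mem (hg j) (setOne_mem_vertexIdeal _ _ (hg j))
    · rw [Finset.insert_union, Finset.compl_insert, hcard]
    · exact hmap ▸ dvd_mul_right _ _
    · rw [setOne_setOne]
      conv_rhs => rw [← hρ, setOne_setOne]
      congr 2
      ext k
      simp
    · exact fun j ↦ setOne_mem_vertexIdeal _ _ (hg j)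
    · rw [Finset.union_insert, Finset.compl_insert, hcard]

/-- The intersection of the vertex ideals is the face ideal. -/
theorem iInf_vertexIdeal_eq_faceIdeal [Fintype ι] (σ : κ → Finset ι) :
    ⨅ j, vertexIdeal R (σ j) = faceIdeal R σ := by
  refine le_antisymm (fun f hf ↦ ?_) (faceIdeal_le_iInf_vertexIdeal σ)
  exact mem_faceIdeal_of_prod_dvd σ (τ := ∅) (ρ := ∅) (by simp) (setOne_empty f)
    (Ideal.mem_iInf.mp hf)

end AddMonoidAlgebra

/-- Let `A = ℤ[z,z⁻¹]` and `S = A[y₁^{±1},…,y_d^{±1}]`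
(`d ≥ 1`).  Given subsets `σ₁,…,σ_m` of `{1,…,d}` (`m ≥ 1`), let `J_j` be the
ideal of `S` generated by `{y_l - 1 : l ∉ σ_j}`.  Then `⋂ⱼ J_j` is the ideal of
`S` generated by the products `∏_{i ∈ τ} (1 - yᵢ)` over all subsets
`τ ⊆ {1,…,d}` not contained in any `σ_j`. -/
theorem stmt4 (d m : ℕ) (hd : 1 ≤ d) (hm : 1 ≤ m) (σ : Fin m → Finset (Fin d)) :
    (⨅ j : Fin m, Ideal.span
        {p : AddMonoidAlgebra (LaurentPolynomial ℤ) (Fin d → ℤ) | ∃ l ∉ σ j,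
          p = AddMonoidAlgebra.single (Pi.single l (1 : ℤ)) (1 : LaurentPolynomial ℤ) - 1}) =
      Ideal.span
        {p : AddMonoidAlgebra (LaurentPolynomial ℤ) (Fin d → ℤ) |
          ∃ τ : Finset (Fin d), (∀ j : Fin m, ¬ τ ⊆ σ j) ∧
            p = ∏ i ∈ τ,
              (1 - AddMonoidAlgebra.single (Pi.single i (1 : ℤ)) (1 : LaurentPolynomial ℤ))} := by
  exact AddMonoidAlgebra.iInf_vertexIdeal_eq_faceIdeal σ
end
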